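/- arXiv:2009.11800 — 3 statements merged into one kernel-verified Lean document; each statement's English description precedes it below -/
import Mathlib

section
/- Let (Q, m, k) be a regular local ring of Krull dimension e ≥ 1 whose residue field k is infinite, and let I be a nonzero ideal of Q with I ⊆ m². Let d ≥ 2 be such that I ⊆ m^d, and let f ∈ I satisfy f ∉ m^{d+1} and f ∉ mI (so f is a minimal generator of I of minimal m-adic order). Then there exist y_2, ..., y_e ∈ m whose images in m/m² are k-linearly independent, such that the ideal J = (f, y_2, ..., y_e) contains I, the sequence f, y_2, ..., y_e is a regular sequence on Q, Q/J is an artinian local ring that is not a field, and f ∉ mJ. -/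
open IsLocalRing

/-- A Noetherian local ring is regular if its maximal ideal can be generated by
`dim Q` elements. -/
def IsRegularLocal (Q : Type*) [CommRing Q] [IsLocalRing Q] [IsNoetherianRing Q] : Prop :=
  ∃ (n : ℕ) (x : Fin n → Q),
    Ideal.span (Set.range x) = maximalIdeal Q ∧ ringKrullDim Q = n

/-- If `w = ∑ cⱼ xⱼ` with `cᵢ` a unit, then `w` can replace `xᵢ` in a generating family. -/
theorem span_range_le_span_insert_of_isUnit {Q : Type*} [CommRing Q] {n : ℕ}
    (x c : Fin (n + 1) → Q) (i : Fin (n + 1)) (hi : IsUnit (c i)) :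
    Ideal.span (Set.range x) ≤
      Ideal.span (insert (∑ j, c j * x j) (Set.range fun j => x (i.succAbove j))) := by
  rw [Ideal.span_le, Set.range_subset_iff]
  have hmem (j : Fin n) : x (i.succAbove j) ∈
      Ideal.span (insert (∑ j, c j * x j) (Set.range fun j => x (i.succAbove j))) :=
    Ideal.subset_span (Set.mem_insert_of_mem _ ⟨j, rfl⟩)
  intro j
  rcases Fin.eq_self_or_eq_succAbove i j with rfl | ⟨j, rfl⟩
  · have hw : (∑ k, c k * x k) ∈
        Ideal.span (insert (∑ k, c k * x k) (Set.range fun k => x (j.succAbove k))) :=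
      Ideal.subset_span (Set.mem_insert _ _)
    rw [Fin.sum_univ_succAbove _ j] at hw
    have hs := Ideal.sum_mem _ fun k (_ : k ∈ Finset.univ) =>
      Ideal.mul_mem_left _ (c (j.succAbove k)) (hmem k)
    rw [Fin.sum_univ_succAbove _ j] at hs
    have := (Ideal.add_mem_iff_left _ hs).mp hw
    rw [← Fin.sum_univ_succAbove (fun k => c k * x k) j] at this
    exact (Ideal.unit_mul_mem_iff_mem _ hi).mp this
  · exact hmem j

theorem isLocalRing_quotient {Q : Type*} [CommRing Q] [IsLocalRing Q] {J : Ideal Q}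
    (hJ : J ≤ maximalIdeal Q) : IsLocalRing (Q ⧸ J) := by
  have : Nontrivial (Q ⧸ J) := Ideal.Quotient.nontrivial_iff.mpr
    (hJ.trans_lt (maximalIdeal.isMaximal Q).lt_top).ne
  exact .of_surjective' (Ideal.Quotient.mk J) Ideal.Quotient.mk_surjective

theorem span_range_mk_eq_maximalIdeal {Q : Type*} [CommRing Q] [IsLocalRing Q] {n : ℕ}
    {x : Fin n → Q} {w : Q} [IsLocalRing (Q ⧸ Ideal.span {w})]
    (hx : Ideal.span (insert w (Set.range x)) = maximalIdeal Q) :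
    Ideal.span (Set.range fun i => Ideal.Quotient.mk (Ideal.span {w}) (x i)) =
      maximalIdeal (Q ⧸ Ideal.span {w}) := by
  rw [← map_maximalIdeal_of_surjective (Ideal.Quotient.mk (Ideal.span {w}))
    Ideal.Quotient.mk_surjective, ← hx, Ideal.span_insert, Ideal.map_sup,
    Ideal.map_quotient_self, bot_sup_eq, Ideal.map_span, ← Set.range_comp]
  rfl

section RegularLocal

variable {Q : Type*} [CommRing Q] [IsLocalRing Q] [IsNoetherianRing Q]

theorem ringKrullDim_le_of_maximalIdeal_mem_minimalPrimes_span {n : ℕ} {x : Fin n → Q}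
    (hx : maximalIdeal Q ∈ (Ideal.span (Set.range x)).minimalPrimes) : ringKrullDim Q ≤ n := by
  rw [← maximalIdeal_height_eq_ringKrullDim]
  have h := Ideal.height_le_spanRank_toENat_of_mem_minimalPrimes _ _ hx
  have h2 : (Ideal.span (Set.range x)).spanRank.toENat ≤ n := by
    rw [Submodule.spanRank_toENat_eq_iInf_encard]
    have hcard : (Set.range x).encard ≤ n := by
      rw [← Set.image_univ]
      exact (Set.encard_image_le _ _).trans (by simp)
    exact (iInf₂_le (f := fun (s : Set Q) (_ : Submodule.span Q s = Ideal.span (Set.range x)) =>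
      s.encard) (Set.range x) rfl).trans hcard
  exact_mod_cast h.trans h2

theorem ringKrullDim_le_of_span_range_eq {n : ℕ} {x : Fin n → Q}
    (hx : Ideal.span (Set.range x) = maximalIdeal Q) : ringKrullDim Q ≤ n := by
  refine ringKrullDim_le_of_maximalIdeal_mem_minimalPrimes_span (x := x) ?_
  rw [hx, Ideal.minimalPrimes_eq_subsingleton_self]
  rfl

/-- A part of a generating family of length `dim Q` of the maximal ideal which omits one element
`z` contains no power of `z` in its span. -/
theorem pow_notMem_span_of_span_insert_eq {n : ℕ} {y : Fin n → Q} {z : Q}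
    (hyz : Ideal.span (insert z (Set.range y)) = maximalIdeal Q)
    (hdim : ringKrullDim Q = (n + 1 : ℕ)) (k : ℕ) : z ^ k ∉ Ideal.span (Set.range y) := by
  intro hz
  have hle : Ideal.span (Set.range y) ≤ maximalIdeal Q :=
    hyz ▸ Ideal.span_mono (Set.subset_insert _ _)
  have h := ringKrullDim_le_of_maximalIdeal_mem_minimalPrimes_span (x := y)
    ⟨⟨inferInstance, hle⟩, fun P ⟨hP, hyP⟩ _ => by
      rw [← hyz, Ideal.span_le, Set.insert_subset_iff]
      exact ⟨hP.mem_of_pow_mem k (hyP hz), fun a ha => hyP (Ideal.subset_span ha)⟩⟩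
  rw [hdim] at h
  have : n + 1 ≤ n := by exact_mod_cast h
  omega

theorem mem_maximalIdeal_of_sum_mem_sq {n : ℕ} {x : Fin n → Q}
    (hx : Ideal.span (Set.range x) = maximalIdeal Q) (hdim : ringKrullDim Q = n) (c : Fin n → Q)
    (hc : ∑ i, c i * x i ∈ maximalIdeal Q ^ 2) (i : Fin n) : c i ∈ maximalIdeal Q := by
  by_contra hi
  obtain _ | n := n
  · exact i.elim0
  have hu : IsUnit (c i) := by simpa using hi
  have hle : maximalIdeal Q ≤ Ideal.span (Set.range fun j => x (i.succAbove j)) := by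
    refine Submodule.le_of_le_smul_of_le_jacobson_bot (I := maximalIdeal Q)
      (IsNoetherian.noetherian _) (maximalIdeal_le_jacobson _) ?_
    refine (hx.symm.le.trans (span_range_le_span_insert_of_isUnit x c i hu)).trans ?_
    rw [Ideal.span_insert, sup_comm, smul_eq_mul, ← pow_two]
    exact sup_le_sup le_rfl ((Ideal.span_singleton_le_iff_mem _).mpr hc)
  have heq : Ideal.span (Set.range fun j => x (i.succAbove j)) = maximalIdeal Q := by
    refine le_antisymm ?_ hle
    rw [← hx]
    exact Ideal.span_mono (Set.range_comp_subset_range i.succAbove x)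
  have h := ringKrullDim_le_of_span_range_eq heq
  rw [hdim] at h
  have : n + 1 ≤ n := by exact_mod_cast h
  omega

theorem ringKrullDim_quotient_span_singleton_of_span_insert_eq {n : ℕ} {x : Fin n → Q} {w : Q}
    (hx : Ideal.span (insert w (Set.range x)) = maximalIdeal Q)
    (hdim : ringKrullDim Q = (n + 1 : ℕ)) :
    ringKrullDim (Q ⧸ Ideal.span {w}) = n := by
  have hw : w ∈ maximalIdeal Q := hx ▸ Ideal.subset_span (Set.mem_insert _ _)
  have := isLocalRing_quotient ((Ideal.span_singleton_le_iff_mem _).mpr hw)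
  refine le_antisymm (ringKrullDim_le_of_span_range_eq (span_range_mk_eq_maximalIdeal hx)) ?_
  have h := ringKrullDim_le_ringKrullDim_quotient_add_encard {w}
    (Set.singleton_subset_iff.mpr (by rwa [ringJacobson_eq_maximalIdeal]))
  rw [hdim, Set.encard_singleton] at h
  by_contra! hlt
  have hle : ((n + 1 : ℕ) : WithBot ℕ∞) ≤ n :=
    h.trans (ENat.WithBot.add_one_le_natCast_iff.mpr hlt)
  have : n + 1 ≤ n := by exact_mod_cast hle
  omega

end RegularLocal

/-- A regular local ring is a domain. -/
theorem isDomain_of_span_range_eq_maximalIdeal (n : ℕ) {Q : Type*} [CommRing Q] [IsLocalRing Q]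
    [IsNoetherianRing Q] {x : Fin n → Q} (hx : Ideal.span (Set.range x) = maximalIdeal Q)
    (hdim : ringKrullDim Q = n) : IsDomain Q := by
  induction n generalizing Q with
  | zero =>
    refine (isField_iff_maximalIdeal_eq.mpr ?_).isDomain
    rw [← hx, Set.range_eq_empty, Ideal.span_empty]
  | succ n ih =>
    have hne : ¬ maximalIdeal Q ≤ maximalIdeal Q ^ 2 := by
      intro h
      have := mem_maximalIdeal_of_sum_mem_sq hx hdim (Pi.single 0 1)
        (h (hx ▸ Ideal.sum_mem _ fun i _ =>
          Ideal.mul_mem_left _ _ (Ideal.subset_span ⟨i, rfl⟩))) 0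
      simp at this
    have hfin := minimalPrimes.finite_of_isNoetherianRing Q
    have hmin (P : Ideal Q) (hP : P ∈ minimalPrimes Q) : ¬ maximalIdeal Q ≤ P := by
      intro h
      have hPm : maximalIdeal Q = P :=
        le_antisymm h (le_maximalIdeal hP.1.1.ne_top)
      have h0 := ringKrullDim_le_of_maximalIdeal_mem_minimalPrimes_span (Q := Q) (n := 0)
        (x := Fin.elim0) (by simpa [hPm] using! hP)
      rw [hdim] at h0
      have : n + 1 ≤ 0 := by exact_mod_cast h0
      omega
    obtain ⟨w, hwm, hw2, hwP⟩ : ∃ w ∈ maximalIdeal Q, w ∉ maximalIdeal Q ^ 2 ∧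
        ∀ P ∈ minimalPrimes Q, w ∉ P := by
      by_contra! hcon
      have hsub : ((maximalIdeal Q : Ideal Q) : Set Q) ⊆
          ⋃ P ∈ ((insert (maximalIdeal Q ^ 2) hfin.toFinset : Finset (Ideal Q)) :
            Set (Ideal Q)), (P : Set Q) := by
        intro w hw
        by_cases h2 : w ∈ maximalIdeal Q ^ 2
        · exact Set.mem_biUnion (x := maximalIdeal Q ^ 2) (by simp) h2
        · obtain ⟨P, hP, hwP⟩ := hcon w hw h2
          exact Set.mem_biUnion (x := P) (by simp [hP]) hwP
      obtain ⟨P, hP, hle⟩ := (Ideal.subset_union_prime (f := id) (maximalIdeal Q ^ 2)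
        (maximalIdeal Q ^ 2) (fun P hP h _ => by
          rcases Finset.mem_insert.mp hP with rfl | hP
          · exact absurd rfl h
          · exact (hfin.mem_toFinset.mp hP).1.1)).mp hsub
      rcases Finset.mem_insert.mp hP with rfl | hP
      · exact hne hle
      · exact hmin P (hfin.mem_toFinset.mp hP) hle
    obtain ⟨c, rfl⟩ : ∃ c : Fin (n + 1) → Q, ∑ i, c i * x i = w := by
      rw [← hx] at hwm
      exact (Ideal.mem_span_range_iff_exists_fun).mp hwm
    obtain ⟨i, hi⟩ : ∃ i, IsUnit (c i) := by
      by_contra! hcon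
      refine hw2 (Ideal.sum_mem _ fun i _ => ?_)
      rw [pow_two]
      exact Ideal.mul_mem_mul ((mem_maximalIdeal _).mpr (hcon i))
        (hx ▸ Ideal.subset_span ⟨i, rfl⟩)
    have hgen : Ideal.span (insert (∑ j, c j * x j) (Set.range fun j => x (i.succAbove j))) =
        maximalIdeal Q := by
      refine le_antisymm ?_ (hx.symm.le.trans (span_range_le_span_insert_of_isUnit x c i hi))
      rw [Ideal.span_le, Set.insert_subset_iff, Set.range_subset_iff]
      exact ⟨hwm, fun j => hx ▸ Ideal.subset_span ⟨_, rfl⟩⟩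
    generalize ∑ j, c j * x j = w at *
    have := isLocalRing_quotient ((Ideal.span_singleton_le_iff_mem _).mpr hwm)
    have hdom := ih (span_range_mk_eq_maximalIdeal hgen)
      (ringKrullDim_quotient_span_singleton_of_span_insert_eq hgen hdim)
    have hprime : (Ideal.span {w}).IsPrime := (Ideal.Quotient.isDomain_iff_prime _).mp hdom
    obtain ⟨P, hP, hPw⟩ := Ideal.exists_minimalPrimes_le (bot_le : ⊥ ≤ Ideal.span {w})
    have hPbot : P = ⊥ := by
      refine Submodule.eq_bot_of_le_smul_of_le_jacobson_bot (maximalIdeal Q) P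
        (IsNoetherian.noetherian _) (fun p hp => ?_) (maximalIdeal_le_jacobson _)
      obtain ⟨q, rfl⟩ := Ideal.mem_span_singleton.mp (hPw hp)
      exact Ideal.mul_mem_mul hwm ((hP.1.1.mem_or_mem hp).resolve_left (hwP P hP))
    have : (⊥ : Ideal Q).IsPrime := hPbot ▸ hP.1.1
    exact IsDomain.of_bot_isPrime Q

open RingTheory.Sequence in
theorem isWeaklyRegular_ofFn_append_singleton (n : ℕ) {Q : Type*} [CommRing Q] [IsLocalRing Q]
    [IsNoetherianRing Q] {y : Fin n → Q} {z f : Q}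
    (hyz : Ideal.span (insert z (Set.range y)) = maximalIdeal Q)
    (hdim : ringKrullDim Q = (n + 1 : ℕ)) (hf : f ∉ Ideal.span (Set.range y)) :
    IsWeaklyRegular Q (List.ofFn y ++ [f]) := by
  have hdom : IsDomain Q :=
    isDomain_of_span_range_eq_maximalIdeal (n + 1) (x := Fin.cons z y) (by
      rwa [Fin.range_cons]) hdim
  induction n generalizing Q with
  | zero =>
    have hf0 : f ≠ 0 := by
      rintro rfl
      exact hf (Ideal.zero_mem _)
    simpa using IsSMulRegular.of_ne_zero hf0
  | succ n ih =>
    have hgen : Ideal.span (insert (y 0) (Set.range (Fin.cons z (Fin.tail y) : Fin (n + 1) → Q))) =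
        maximalIdeal Q := by
      rw [Fin.range_cons, Set.insert_comm, ← Fin.range_cons, Fin.cons_self_tail, hyz]
    have hdimq := ringKrullDim_quotient_span_singleton_of_span_insert_eq hgen hdim
    have hym : y 0 ∈ maximalIdeal Q := hgen ▸ Ideal.subset_span (Set.mem_insert _ _)
    have := isLocalRing_quotient ((Ideal.span_singleton_le_iff_mem _).mpr hym)
    have hgenq := span_range_mk_eq_maximalIdeal hgen
    have hgenq' : Ideal.span (insert (Ideal.Quotient.mk (Ideal.span {y 0}) z)
        (Set.range fun i => Ideal.Quotient.mk (Ideal.span {y 0}) (y (Fin.succ i)))) =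
        maximalIdeal (Q ⧸ Ideal.span {y 0}) := by
      rw [← hgenq, ← Fin.range_cons]
      congr 2
      funext i
      refine Fin.cases ?_ (fun i => ?_) i <;> rfl
    have hy0 : y 0 ≠ 0 := by
      intro h0
      have hle := ringKrullDim_le_of_span_range_eq
        (x := (Fin.cons z (Fin.tail y) : Fin (n + 1) → Q)) (by
          rw [← hgen, h0, Ideal.span_insert_zero])
      rw [hdim] at hle
      have : n + 1 + 1 ≤ n + 1 := by exact_mod_cast hle
      omega
    have hfq : Ideal.Quotient.mk (Ideal.span {y 0}) f ∉
        Ideal.span (Set.range fun i => Ideal.Quotient.mk (Ideal.span {y 0}) (y (Fin.succ i))) := by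
      intro h
      apply hf
      have hmap : Ideal.span (Set.range fun i => Ideal.Quotient.mk (Ideal.span {y 0})
          (y (Fin.succ i))) = (Ideal.span (Set.range y)).map
            (Ideal.Quotient.mk (Ideal.span {y 0})) := by
        have hrange : Set.range y = insert (y 0) (Set.range (Fin.tail y)) := by
          rw [← Fin.range_cons, Fin.cons_self_tail]
        rw [hrange, Ideal.span_insert, Ideal.map_sup, Ideal.map_quotient_self, bot_sup_eq,
          Ideal.map_span, ← Set.range_comp]
        rfl
      rw [hmap] at h
      refine (Ideal.mem_quotient_iff_mem ?_).mp h
      exact Ideal.span_mono (Set.singleton_subset_iff.mpr ⟨0, rfl⟩)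
    have hdomq := isDomain_of_span_range_eq_maximalIdeal (n + 1) hgenq hdimq
    have hreg := ih hgenq' hdimq hfq hdomq
    have hmap : (List.ofFn fun i => Ideal.Quotient.mk (Ideal.span {y 0}) (y (Fin.succ i))) ++
        [Ideal.Quotient.mk (Ideal.span {y 0}) f] =
        ((List.ofFn fun i => y (Fin.succ i)) ++ [f]).map
          (algebraMap Q (Q ⧸ Ideal.span {y 0})) := by
      simp [List.map_ofFn, Function.comp_def]
    rw [hmap, isWeaklyRegular_map_algebraMap_iff] at hreg
    rw [List.ofFn_succ, List.cons_append, isWeaklyRegular_cons_iff]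
    refine ⟨IsSMulRegular.of_ne_zero hy0, ?_⟩
    refine (LinearEquiv.isWeaklyRegular_congr (Submodule.quotEquivOfEq _ _ ?_) _).mp hreg
    simp [← Submodule.ideal_span_singleton_smul]

/-- Over an infinite residue field, an element of order exactly `d` is, at a suitable point,
given by a form of degree `d` taking a unit value. -/
theorem exists_isHomogeneous_isUnit_eval {Q : Type*} [CommRing Q] [IsLocalRing Q]
    [Infinite (ResidueField Q)] {n d : ℕ} {x : Fin n → Q}
    (hx : Ideal.span (Set.range x) = maximalIdeal Q) {f : Q}
    (hf : f ∈ maximalIdeal Q ^ d) (hf' : f ∉ maximalIdeal Q ^ (d + 1)) :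
    ∃ F : MvPolynomial (Fin n) Q, F.IsHomogeneous d ∧ F.eval x = f ∧
      ∃ a : Fin n → Q, IsUnit (F.eval a) := by
  rw [← hx, Ideal.mem_span_pow_iff_exists_isHomogeneous] at hf
  obtain ⟨F, hF, rfl⟩ := hf
  refine ⟨F, hF, rfl, ?_⟩
  by_contra! hcon
  have h0 : F.map (residue Q) = 0 := by
    refine MvPolynomial.funext fun b => ?_
    choose a ha using fun i => residue_surjective (b i)
    have hb : residue Q ∘ a = b := funext ha
    rw [map_zero, ← hb, MvPolynomial.eval_map, ← MvPolynomial.eval₂_comp, residue_eq_zero_iff]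
    exact (mem_maximalIdeal _).mpr (hcon a)
  apply hf'
  rw [MvPolynomial.eval_eq]
  refine Ideal.sum_mem _ fun s hs => ?_
  rw [pow_succ']
  refine Ideal.mul_mem_mul ?_ ?_
  · rw [← residue_eq_zero_iff, ← MvPolynomial.coeff_map, h0, MvPolynomial.coeff_zero]
  · rw [← hx, Ideal.mem_span_pow_iff_exists_isHomogeneous]
    refine ⟨MvPolynomial.monomial s 1, MvPolynomial.isHomogeneous_monomial _ ?_, ?_⟩
    · have := hF (MvPolynomial.mem_support_iff.mp hs)
      rwa [Pi.one_def, ← Finsupp.degree_eq_weight_one] at this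
    · simp [MvPolynomial.eval_monomial, Finsupp.prod]

theorem eval_sub_eval_mem {ι R : Type*} [CommRing R] (F : MvPolynomial ι R) {u v : ι → R}
    {J : Ideal R} (h : ∀ i, u i - v i ∈ J) : F.eval u - F.eval v ∈ J := by
  rw [← Ideal.Quotient.eq, MvPolynomial.eval₂_comp, MvPolynomial.eval₂_comp]
  congr 1
  funext i
  exact Ideal.Quotient.eq.mpr (h i)

theorem eval_mul_of_isHomogeneous {ι R : Type*} [CommRing R] {F : MvPolynomial ι R} {d : ℕ}
    (hF : F.IsHomogeneous d) (r : R) (u : ι → R) :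
    F.eval (fun i => r * u i) = r ^ d * F.eval u := by
  rw [MvPolynomial.eval_eq, MvPolynomial.eval_eq, Finset.mul_sum]
  refine Finset.sum_congr rfl fun s hs => ?_
  have hs' := hF (MvPolynomial.mem_support_iff.mp hs)
  rw [Pi.one_def, ← Finsupp.degree_eq_weight_one, Finsupp.degree_apply] at hs'
  simp_rw [mul_pow]
  rw [Finset.prod_mul_distrib, Finset.prod_pow_eq_pow_sum, hs']
  ring

theorem exists_span_insert_eq_maximalIdeal_and_pow_mem {Q : Type*} [CommRing Q] [IsLocalRing Q]
    [Infinite (ResidueField Q)] {n d : ℕ} (hd : d ≠ 0) {x : Fin (n + 1) → Q}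
    (hx : Ideal.span (Set.range x) = maximalIdeal Q) {f : Q}
    (hf : f ∈ maximalIdeal Q ^ d) (hf' : f ∉ maximalIdeal Q ^ (d + 1)) :
    ∃ (z : Q) (y : Fin n → Q), Ideal.span (insert z (Set.range y)) = maximalIdeal Q ∧
      ∃ u v : Q, IsUnit u ∧ IsUnit v ∧ u * f - v * z ^ d ∈ Ideal.span (Set.range y) := by
  obtain ⟨F, hF, rfl, a, ha⟩ := exists_isHomogeneous_isUnit_eval hx hf hf'
  obtain ⟨i, hi⟩ : ∃ i, IsUnit (a i) := by
    by_contra! hcon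
    refine (mem_maximalIdeal _).mp (Ideal.pow_le_self hd ?_) ha
    refine Ideal.pow_right_mono (Ideal.span_le.mpr (Set.range_subset_iff.mpr fun j => ?_)) d
      ((Ideal.mem_span_pow_iff_exists_isHomogeneous a _).mpr ⟨F, hF, rfl⟩)
    exact (mem_maximalIdeal _).mpr (hcon j)
  set y : Fin n → Q := fun j => a i * x (i.succAbove j) - a (i.succAbove j) * x i
  have hy (j : Fin (n + 1)) : a i * x j - x i * a j ∈ Ideal.span (Set.range y) := by
    rcases Fin.eq_self_or_eq_succAbove i j with rfl | ⟨j, rfl⟩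
    · rw [mul_comm, sub_self]
      exact Ideal.zero_mem _
    · exact Ideal.subset_span ⟨j, by simp only [y]; ring⟩
  refine ⟨x i, y, le_antisymm ?_ ?_, a i ^ d, F.eval a, hi.pow d, ha, ?_⟩
  · have hxm (j) : x j ∈ maximalIdeal Q := hx ▸ Ideal.subset_span ⟨j, rfl⟩
    rw [Ideal.span_le, Set.insert_subset_iff, Set.range_subset_iff]
    exact ⟨hxm i, fun j => Ideal.sub_mem _ (Ideal.mul_mem_left _ _ (hxm _))
      (Ideal.mul_mem_left _ _ (hxm _))⟩
  · rw [← hx, Ideal.span_le, Set.range_subset_iff]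
    intro j
    refine (Ideal.unit_mul_mem_iff_mem _ hi).mp ?_
    rw [← sub_add_cancel (a i * x j) (x i * a j)]
    exact Ideal.add_mem _ (Ideal.span_mono (Set.subset_insert _ _) (hy j))
      (Ideal.mul_mem_right _ _ (Ideal.subset_span (Set.mem_insert _ _)))
  · rw [mul_comm (F.eval a), ← eval_mul_of_isHomogeneous hF, ← eval_mul_of_isHomogeneous hF]
    exact eval_sub_eval_mem F hy

theorem Ideal.sup_pow_le_pow_sup {R : Type*} [CommRing R] (A B : Ideal R) (k : ℕ) :
    (A ⊔ B) ^ k ≤ A ^ k ⊔ B := by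
  induction k with
  | zero => simp
  | succ k ih =>
    rw [pow_succ, pow_succ]
    refine (Ideal.mul_mono_left ih).trans ?_
    rw [Ideal.sup_mul, Ideal.mul_sup]
    exact sup_le (sup_le le_sup_left (Ideal.mul_le_right.trans le_sup_right))
      (Ideal.mul_le_left.trans le_sup_right)

/-- **Lemma 3.2.** Let `(Q, 𝔪, k)` be a regular local ring of Krull dimension `e ≥ 1` with
infinite residue field, and let `I ≠ 0` be an ideal with `I ⊆ 𝔪²`.  Let `d ≥ 2` be such that
`I ⊆ 𝔪^d`, and let `f ∈ I` satisfy `f ∉ 𝔪^{d+1}` and `f ∉ 𝔪I`.  Then there exist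
`y_2, …, y_e ∈ 𝔪`, linearly independent modulo `𝔪²`, such that `J = (f, y_2, …, y_e)`
contains `I`, the sequence `f, y_2, …, y_e` is `Q`-regular, `Q/J` is artinian local and not a
field, and `f ∉ 𝔪J`. -/
theorem stmt1 (Q : Type*) [CommRing Q] [IsLocalRing Q] [IsNoetherianRing Q]
    (hreg : IsRegularLocal Q)
    (e : ℕ) (he : 1 ≤ e) (hdim : ringKrullDim Q = e)
    [Infinite (ResidueField Q)]
    (I : Ideal Q) (hI0 : I ≠ ⊥) (hI2 : I ≤ maximalIdeal Q ^ 2)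
    (d : ℕ) (hd : 2 ≤ d) (hId : I ≤ maximalIdeal Q ^ d)
    (f : Q) (hfI : f ∈ I) (hford : f ∉ maximalIdeal Q ^ (d + 1))
    (hfmin : f ∉ maximalIdeal Q * I) :
    ∃ (y : Fin (e - 1) → Q) (J : Ideal Q),
      J = Ideal.span (insert f (Set.range y)) ∧
      (∀ i, y i ∈ maximalIdeal Q) ∧
      (∀ c : Fin (e - 1) → Q,
        (∑ i, c i * y i) ∈ maximalIdeal Q ^ 2 → ∀ i, c i ∈ maximalIdeal Q) ∧
      I ≤ J ∧
      RingTheory.Sequence.IsRegular Q (f :: List.ofFn y) ∧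
      IsArtinianRing (Q ⧸ J) ∧ IsLocalRing (Q ⧸ J) ∧ ¬ IsField (Q ⧸ J) ∧
      f ∉ maximalIdeal Q * J := by
  obtain ⟨n, x, hx, hn⟩ := hreg
  obtain rfl : n = e := by exact_mod_cast hn.symm.trans hdim
  obtain ⟨n, rfl⟩ : ∃ k, n = k + 1 := ⟨n - 1, by omega⟩
  obtain ⟨z, y, hyz, u, v, hu, hv, huv⟩ :=
    exists_span_insert_eq_maximalIdeal_and_pow_mem (by omega) hx (hId hfI) hford
  have hym (i) : y i ∈ maximalIdeal Q :=
    hyz ▸ Ideal.subset_span (Set.mem_insert_of_mem _ ⟨i, rfl⟩)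
  have hfy : f ∉ Ideal.span (Set.range y) := fun hf =>
    pow_notMem_span_of_span_insert_eq hyz hdim d <| (Ideal.unit_mul_mem_iff_mem _ hv).mp <|
      (Submodule.sub_mem_iff_right _ (Ideal.mul_mem_left _ u hf)).mp huv
  have hfm : f ∈ maximalIdeal Q ^ 2 := hI2 hfI
  have hfm1 : f ∈ maximalIdeal Q := Ideal.pow_le_self two_ne_zero hfm
  set J := Ideal.span (insert f (Set.range y)) with hJ
  have hyJ : Ideal.span (Set.range y) ≤ J := Ideal.span_mono (Set.subset_insert _ _)
  have hfJ : f ∈ J := Ideal.subset_span (Set.mem_insert _ _)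
  have hJm : J ≤ maximalIdeal Q := by
    rw [hJ, Ideal.span_le, Set.insert_subset_iff, Set.range_subset_iff]
    exact ⟨hfm1, hym⟩
  have hzJ : z ^ d ∈ J := (Ideal.unit_mul_mem_iff_mem _ hv).mp <|
    (Submodule.sub_mem_iff_right _ (Ideal.mul_mem_left _ u hfJ)).mp (hyJ huv)
  have hmJ : maximalIdeal Q ^ d ≤ J := by
    rw [← hyz, Ideal.span_insert]
    refine (Ideal.sup_pow_le_pow_sup _ _ _).trans (sup_le ?_ hyJ)
    rwa [Ideal.span_singleton_pow, Ideal.span_singleton_le_iff_mem]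
  have hloc := isLocalRing_quotient hJm
  have hmap := map_maximalIdeal_of_surjective (Ideal.Quotient.mk J) Ideal.Quotient.mk_surjective
  refine ⟨y, J, rfl, hym, fun c hc i => ?_, hId.trans hmJ, ?_, ?_, hloc, fun hfield => ?_,
    fun hmem => ?_⟩
  · refine mem_maximalIdeal_of_sum_mem_sq (x := (Fin.cons z y : Fin (n + 1) → Q))
      (by rwa [Fin.range_cons]) hdim (Fin.cons 0 c) ?_ i.succ
    simpa [Fin.sum_univ_succ] using hc
  · have hw := isWeaklyRegular_ofFn_append_singleton n hyz hdim hfy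
    have hmem : ∀ r ∈ f :: List.ofFn y, r ∈ maximalIdeal Q := by
      simp only [List.mem_cons, List.mem_ofFn']
      rintro r (rfl | ⟨i, rfl⟩)
      exacts [hfm1, hym i]
    rw [isRegular_iff_isWeaklyRegular_of_subset_maximalIdeal hmem]
    exact isWeaklyRegular_of_perm_of_subset_maximalIdeal hw (List.perm_append_singleton _ _)
      fun r hr => hmem r ((List.perm_append_singleton _ _).mem_iff.mp hr)
  · rw [isArtinianRing_iff_isNilpotent_maximalIdeal]
    refine ⟨d, ?_⟩
    rw [← hmap, ← Ideal.map_pow]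
    exact (Ideal.map_eq_bot_iff_le_ker _).mpr (by rwa [Ideal.mk_ker])
  · rw [isField_iff_maximalIdeal_eq, ← hmap, Ideal.map_eq_bot_iff_le_ker, Ideal.mk_ker] at hfield
    have hle : maximalIdeal Q ≤ Ideal.span (Set.range y) := by
      refine Submodule.le_of_le_smul_of_le_jacobson_bot (I := maximalIdeal Q)
        (IsNoetherian.noetherian _) (maximalIdeal_le_jacobson _) (hfield.trans ?_)
      rw [hJ, Ideal.span_insert, sup_comm, smul_eq_mul, ← pow_two]
      exact sup_le_sup le_rfl ((Ideal.span_singleton_le_iff_mem _).mpr hfm)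
    refine pow_notMem_span_of_span_insert_eq hyz hdim 1 (hle ?_)
    rw [pow_one, ← hyz]
    exact Ideal.subset_span (Set.mem_insert _ _)
  · rw [hJ, Ideal.span_insert, Ideal.mul_sup] at hmem
    obtain ⟨p, hp, q, hq, hpq⟩ := Submodule.mem_sup.mp hmem
    obtain ⟨r, hr, rfl⟩ := Ideal.mem_mul_span_singleton.mp hp
    refine hfy ((Ideal.unit_mul_mem_iff_mem _ (isUnit_one_sub_self_of_mem_nonunits r hr)).mp ?_)
    have hfq : (1 - r) * f = q := by linear_combination -hpq
    rw [hfq]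
    exact Ideal.mul_le_right hq
end

section
/- Let k be a field with char k ≠ 2 and let Q = k⟦x, y, z⟧ be the formal power series ring, with maximal ideal m = (x, y, z). Set I = (x² − y², x² − z², xy, xz, yz) and J_1 = (x² − y², y − z, x), J_2 = (y² − z², y, x), J_3 = (xy, x − y, x − z), J_4 = (x² − y² + yz − xy, y − z, x − y − z), J_5 = (xy − xz, y, x − z). Then I ⊆ J_i for each i = 1, ..., 5; each of the five listed generating triples is a regular sequence on Q, so each Q/J_i is artinian; and for every g ∈ I, if g ∈ mJ_i for all i = 1, ..., 5, then g ∈ mI. -/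
open MvPowerSeries

theorem MvPowerSeries.mem_span_X_image {σ R : Type*} [CommRing R] (s : Finset σ)
    (f : MvPowerSeries σ R) (h : ∀ n : σ →₀ ℕ, (∀ i ∈ s, n i = 0) → coeff n f = 0) :
    f ∈ Ideal.span (X '' (s : Set σ) : Set (MvPowerSeries σ R)) := by
  classical
  induction s using Finset.induction_on generalizing f with
  | empty =>
    have : f = 0 := by ext n; simpa using h n (by simp)
    simp [this]
  | insert a s ha ih =>
    let f₁ : MvPowerSeries σ R := fun n => if n a = 0 then coeff n f else 0
    have hf₁ (n : σ →₀ ℕ) : coeff n f₁ = if n a = 0 then coeff n f else 0 := rfl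
    have h₁ : f₁ ∈ Ideal.span (X '' (s : Set σ) : Set (MvPowerSeries σ R)) := by
      refine ih f₁ fun n hn => ?_
      rw [hf₁]
      split_ifs with hna
      · exact h n (by simpa [hna] using hn)
      · rfl
    have h₂ : X a ∣ f - f₁ := X_dvd_iff.2 fun n hn => by simp [hf₁, hn]
    rw [← sub_add_cancel f f₁]
    refine add_mem (Ideal.mem_of_dvd _ h₂ (Ideal.subset_span ⟨a, by simp, rfl⟩)) ?_
    exact Ideal.span_mono (Set.image_mono (by simp)) h₁

theorem MvPowerSeries.span_X_image_eq_ker {σ R : Type*} [CommRing R] (s : Finset σ) :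
    Ideal.span (X '' (s : Set σ) : Set (MvPowerSeries σ R)) =
      RingHom.ker (killCompl (R := R) (Function.Embedding.subtype (fun i : σ => i ∉ s))) := by
  classical
  refine le_antisymm (Ideal.span_le.2 ?_) fun f hf => mem_span_X_image s f fun n hn => ?_
  · rintro _ ⟨i, hi, rfl⟩
    exact killCompl_X_eq_zero (by simpa using hi)
  · have := congrArg (coeff (n.subtypeDomain (· ∉ s))) (RingHom.mem_ker.1 hf)
    rw [coeff_killCompl, map_zero] at this
    convert this using 3
    ext i
    by_cases hi : i ∈ s
    · rw [hn i hi, Finsupp.embDomain_of_notMem_range]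
      simpa using hi
    · exact (Finsupp.embDomain_apply_self (Function.Embedding.subtype (fun i : σ => i ∉ s))
        (n.subtypeDomain (· ∉ s)) ⟨i, hi⟩).symm

theorem MvPowerSeries.isPrime_span_X_image {σ R : Type*} [CommRing R] [IsDomain R]
    (s : Finset σ) : (Ideal.span (X '' (s : Set σ) : Set (MvPowerSeries σ R))).IsPrime := by
  rw [span_X_image_eq_ker]
  have : IsDomain (MvPowerSeries {i // i ∉ s} R) := NoZeroDivisors.to_isDomain _
  exact RingHom.ker_isPrime _

theorem MvPowerSeries.mem_span_range_X {σ R : Type*} [Finite σ] [CommRing R]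
    {f : MvPowerSeries σ R} (hf : constantCoeff f = 0) :
    f ∈ Ideal.span (Set.range (X : σ → MvPowerSeries σ R)) := by
  have := Fintype.ofFinite σ
  have h := mem_span_X_image Finset.univ f fun n hn => by
    obtain rfl : n = 0 := by ext i; exact hn i (Finset.mem_univ i)
    simpa using hf
  simpa using h

theorem MvPowerSeries.isArtinianRing_quotient {σ k : Type*} [Finite σ] [Field k]
    {J : Ideal (MvPowerSeries σ k)} (hJ : ∀ i j, X i * X j ∈ J) :
    IsArtinianRing (MvPowerSeries σ k ⧸ J) := by
  have := Fintype.ofFinite σ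
  let N : Submodule k (MvPowerSeries σ k ⧸ J) :=
    Submodule.span k (insert 1 (Set.range fun i => Ideal.Quotient.mk J (X i)))
  have hsub (f : MvPowerSeries σ k) :
      f - C (constantCoeff f) ∈ Ideal.span (Set.range (X : σ → MvPowerSeries σ k)) :=
    mem_span_range_X (by simp)
  have hC (r : k) (f : MvPowerSeries σ k) :
      Ideal.Quotient.mk J (C r * f) = r • Ideal.Quotient.mk J f := by
    rw [← smul_eq_C_mul]; rfl
  have hN (i : σ) (c : MvPowerSeries σ k) : Ideal.Quotient.mk J (c * X i) ∈ N := by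
    rw [← sub_add_cancel c (C (constantCoeff c)), add_mul, map_add, hC]
    refine add_mem ?_ (N.smul_mem _ (Submodule.subset_span (by simp)))
    have h : (c - C (constantCoeff c)) * X i ∈ J := by
      have hle : Ideal.span (Set.range (X : σ → MvPowerSeries σ k)) * Ideal.span {X i} ≤ J := by
        rw [Ideal.span_mul_span', Ideal.span_le]
        rintro _ ⟨_, ⟨j, rfl⟩, _, rfl, rfl⟩
        exact hJ j i
      exact hle (Ideal.mul_mem_mul (hsub c) (Ideal.mem_span_singleton_self _))
    rw [Ideal.Quotient.eq_zero_iff_mem.2 h]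
    exact zero_mem _
  have htop : N = ⊤ := by
    refine eq_top_iff.2 fun q _ => ?_
    obtain ⟨f, rfl⟩ := Ideal.Quotient.mk_surjective q
    obtain ⟨c, hc⟩ := Ideal.mem_span_range_iff_exists_fun.1 (hsub f)
    rw [← sub_add_cancel f (C (constantCoeff f)), ← hc, map_add, map_sum,
      ← mul_one (C _), hC, map_one]
    exact add_mem (sum_mem fun i _ => hN i (c i)) (N.smul_mem _ (Submodule.subset_span (by simp)))
  have : Module.Finite k (MvPowerSeries σ k ⧸ J) :=
    ⟨htop ▸ Submodule.fg_span ((Set.finite_range _).insert _)⟩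
  exact IsArtinianRing.of_finite k _

theorem RingTheory.Sequence.isRegular_triple_of_isPrime {R : Type*} [CommRing R] [IsDomain R]
    {q a b : R} (ha0 : a ≠ 0) (ha : (Ideal.span {a}).IsPrime) (hab : (Ideal.span {a, b}).IsPrime)
    (hb : b ∉ Ideal.span {a}) (hq : q ∉ Ideal.span {a, b})
    (htop : Ideal.span {q, a, b} ≠ ⊤) :
    IsRegular R [q, a, b] := by
  have hqa : q ∉ Ideal.span {a} := fun h => hq (Ideal.span_mono (by simp) h)
  have hq0 : q ≠ 0 := by rintro rfl; exact hqa (zero_mem _)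
  refine ⟨⟨fun i hi => ?_⟩, ?_⟩
  · rw [isSMulRegular_quotient_iff_mem_of_smul_mem]
    intro f hf
    simp only [List.length_cons, List.length_nil] at hi
    interval_cases i
    · simpa [hq0] using hf
    · simp only [List.take, Ideal.ofList_singleton, List.getElem_cons_succ, List.getElem_cons_zero,
        smul_eq_mul, Ideal.mul_top, Ideal.mem_span_singleton'] at hf ⊢
      obtain ⟨h, hh⟩ := hf
      obtain ⟨h', rfl⟩ := Ideal.mem_span_singleton'.1
        ((ha.mem_or_mem (Ideal.mem_span_singleton'.2 ⟨f, by rw [hh, mul_comm]⟩ :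
          h * q ∈ Ideal.span {a})).resolve_right hqa)
      exact ⟨h', mul_left_cancel₀ ha0 (by linear_combination hh)⟩
    · have hlist : Ideal.ofList (List.take 2 [q, a, b]) = Ideal.span {q, a} := by
        simp [Ideal.span_insert]
      simp only [hlist, List.getElem_cons_succ, List.getElem_cons_zero,
        smul_eq_mul, Ideal.mul_top, Ideal.mem_span_pair] at hf ⊢
      obtain ⟨c, d, hcd⟩ := hf
      have hc : c ∈ Ideal.span {a, b} := by
        refine (hab.mem_or_mem (?_ : c * q ∈ _)).resolve_right hq
        exact Ideal.mem_span_pair.2 ⟨-d, f, by linear_combination -hcd⟩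
      obtain ⟨u, v, rfl⟩ := Ideal.mem_span_pair.1 hc
      have hf : f - v * q ∈ Ideal.span {a} := by
        refine (ha.mem_or_mem (?_ : b * (f - v * q) ∈ _)).resolve_left hb
        exact Ideal.mem_span_singleton'.2 ⟨u * q + d, by linear_combination hcd⟩
      obtain ⟨w, hw⟩ := Ideal.mem_span_singleton'.1 hf
      exact ⟨v, w, by linear_combination hw⟩
  · simpa [Ideal.span_insert] using htop.symm

theorem MvPowerSeries.exists_ringHom_powerSeries_line {σ R : Type*} [Finite σ] [CommRing R]
    (p : σ → R) : ∃ φ : MvPowerSeries σ R →+* PowerSeries R,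
      (∀ i, φ (X i) = PowerSeries.C (p i) * PowerSeries.X) ∧
      ∀ f, PowerSeries.constantCoeff (φ f) = constantCoeff f := by
  have ha : HasSubst (fun i => PowerSeries.C (p i) * PowerSeries.X : σ → MvPowerSeries Unit R) :=
    hasSubst_of_constantCoeff_zero fun i => by
      change PowerSeries.constantCoeff _ = _
      simp
  let φ : MvPowerSeries σ R →ₐ[R] MvPowerSeries Unit R := substAlgHom ha
  have hX (i : σ) : φ (X i) = PowerSeries.C (p i) * PowerSeries.X := substAlgHom_X ha i
  refine ⟨φ.toRingHom, hX, fun f => ?_⟩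
  have hf : f - C (constantCoeff f) ∈ Ideal.span (Set.range (X : σ → MvPowerSeries σ R)) :=
    mem_span_range_X (by simp)
  have hle : Ideal.span (Set.range (X : σ → MvPowerSeries σ R)) ≤
      RingHom.ker ((constantCoeff (σ := Unit) (R := R)).comp φ.toRingHom) := by
    rw [Ideal.span_le]
    rintro _ ⟨i, rfl⟩
    change PowerSeries.constantCoeff (φ (X i)) = 0
    rw [hX]
    simp
  have h := hle hf
  have hC : φ (C (constantCoeff f)) = C (constantCoeff f) := φ.commutes _
  rw [RingHom.mem_ker, map_sub, sub_eq_zero] at h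
  refine h.trans ?_
  change constantCoeff (φ (C (constantCoeff f))) = _
  rw [hC, constantCoeff_C]

theorem MvPowerSeries.exists_ringEquiv_subst {σ R : Type*} [Finite σ] [CommRing R]
    (a b : σ → MvPowerSeries σ R) (ha : ∀ i, constantCoeff (a i) = 0)
    (hb : ∀ i, constantCoeff (b i) = 0)
    (hab : ∀ φ : MvPowerSeries σ R →+* MvPowerSeries σ R,
      (∀ i, φ (X i) = a i) → ∀ i, φ (b i) = X i)
    (hba : ∀ φ : MvPowerSeries σ R →+* MvPowerSeries σ R,
      (∀ i, φ (X i) = b i) → ∀ i, φ (a i) = X i) :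
    ∃ e : MvPowerSeries σ R ≃+* MvPowerSeries σ R, ∀ i, e (X i) = a i := by
  have ha' := hasSubst_of_constantCoeff_zero ha
  have hb' := hasSubst_of_constantCoeff_zero hb
  have hab' (i : σ) : subst a (b i) = X i :=
    (substAlgHom_apply ha' _).symm.trans <|
      hab (substAlgHom (R := R) ha').toRingHom (substAlgHom_X ha') i
  have hba' (i : σ) : subst b (a i) = X i :=
    (substAlgHom_apply hb' _).symm.trans <|
      hba (substAlgHom (R := R) hb').toRingHom (substAlgHom_X hb') i
  refine ⟨RingEquiv.ofRingHom (substAlgHom (R := R) ha').toRingHom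
    (substAlgHom (R := R) hb').toRingHom ?_ ?_, fun i => substAlgHom_X ha' i⟩
  · ext1 f
    change substAlgHom ha' (substAlgHom hb' f) = f
    rw [substAlgHom_apply, substAlgHom_apply, subst_comp_subst_apply hb' ha']
    simp_rw [hab']
    exact congrFun subst_self f
  · ext1 f
    change substAlgHom hb' (substAlgHom ha' f) = f
    rw [substAlgHom_apply, substAlgHom_apply, subst_comp_subst_apply ha' hb']
    simp_rw [hba']
    exact congrFun subst_self f

theorem MvPowerSeries.isRegular_of_ringEquiv {σ k S : Type*} [Finite σ] [DecidableEq σ] [Field k]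
    [CommRing S] (e : MvPowerSeries σ k ≃+* MvPowerSeries σ k) (φ : MvPowerSeries σ k →+* S)
    {i j : σ} (hij : i ≠ j) {q a b : MvPowerSeries σ k} (hi : e (X i) = a) (hj : e (X j) = b)
    (hφa : φ a = 0) (hφb : φ b = 0) (hφq : φ q ≠ 0)
    (hq : constantCoeff q = 0) (ha : constantCoeff a = 0) (hb : constantCoeff b = 0) :
    RingTheory.Sequence.IsRegular (MvPowerSeries σ k) [q, a, b] := by
  subst hi hj
  have : IsDomain (MvPowerSeries σ k) := NoZeroDivisors.to_isDomain _
  refine RingTheory.Sequence.isRegular_triple_of_isPrime ?_ ?_ ?_ ?_ ?_ ?_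
  · rw [map_ne_zero_iff e e.injective]
    intro h
    have := congrArg (coeff (Finsupp.single i 1)) h
    simp [coeff_X] at this
  · have := isPrime_span_X_image (R := k) ({i} : Finset σ)
    have := Ideal.map_isPrime_of_equiv e (I := Ideal.span (X '' (({i} : Finset σ) : Set σ)))
    simpa [Ideal.map_span] using this
  · have := isPrime_span_X_image (R := k) ({i, j} : Finset σ)
    have := Ideal.map_isPrime_of_equiv e (I := Ideal.span (X '' (({i, j} : Finset σ) : Set σ)))
    simpa [Ideal.map_span, Set.image_insert_eq] using this
  · rw [Ideal.mem_span_singleton, map_dvd_iff, X_dvd_iff]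
    intro h
    have := h (Finsupp.single j 1) (by simp [hij.symm])
    simp [coeff_X] at this
  · intro h
    refine hφq ?_
    have hle : Ideal.span {e (X i), e (X j)} ≤ RingHom.ker φ := by
      simp [Ideal.span_le, Set.insert_subset_iff, hφa, hφb]
    exact hle h
  · refine ne_top_of_le_ne_top (RingHom.ker_ne_top (constantCoeff (σ := σ) (R := k))) ?_
    simp [Ideal.span_le, Set.insert_subset_iff, hq, ha, hb]

theorem PowerSeries.X_pow_dvd_of_mem_mul_span {R S : Type*} [CommRing R] [CommRing S]
    (φ : S →+* PowerSeries R) {m : Ideal S} {q a b g : S} {n : ℕ}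
    (hm : ∀ f ∈ m, PowerSeries.X ∣ φ f)
    (hq : PowerSeries.X ^ n ∣ φ q) (ha : φ a = 0) (hb : φ b = 0)
    (hg : g ∈ m * Ideal.span {q, a, b}) : PowerSeries.X ^ (n + 1) ∣ φ g := by
  have hle : Ideal.span {q, a, b} ≤ (Ideal.span {PowerSeries.X ^ n}).comap φ := by
    simp [Ideal.span_le, Set.insert_subset_iff, Ideal.mem_span_singleton, ha, hb, hq]
  induction hg using Submodule.mul_induction_on' with
  | mem_mul_mem u hu v hv =>
    rw [map_mul, pow_succ']
    exact mul_dvd_mul (hm u hu) (Ideal.mem_span_singleton.1 (hle hv))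
  | add u _ v _ hu hv => rw [map_add]; exact dvd_add hu hv

theorem MvPowerSeries.X_mul_X_mem_of_line {σ R : Type*} [CommRing R]
    {J : Ideal (MvPowerSeries σ R)} (p : σ → R) (t : MvPowerSeries σ R)
    (h : ∀ i, X i - C (p i) * t ∈ J) (ht : t ^ 2 ∈ J) (i j : σ) : X i * X j ∈ J := by
  have : X i * X j = X j * (X i - C (p i) * t) + C (p i) * t * (X j - C (p j) * t) +
      C (p i) * C (p j) * t ^ 2 := by ring
  rw [this]
  exact add_mem (add_mem (J.mul_mem_left _ (h i)) (J.mul_mem_left _ (h j))) (J.mul_mem_left _ ht)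

theorem Ideal.mem_span_triple_of_eq {R : Type*} [CommRing R] {q a b f : R} (u v w : R)
    (h : f = u * q + v * a + w * b) : f ∈ Ideal.span {q, a, b} := by
  rw [h]
  exact add_mem (add_mem (Ideal.mul_mem_left _ _ (Ideal.subset_span (by simp)))
    (Ideal.mul_mem_left _ _ (Ideal.subset_span (by simp))))
    (Ideal.mul_mem_left _ _ (Ideal.subset_span (by simp)))

/-- The conclusions about one ideal `J = (q, a, b)`, where `a` and `b` are linear forms whose
common zero is the line through `p`, and `t` is a coordinate on that line. -/
theorem MvPowerSeries.triple_facts {k : Type*} [Field k] (p : Fin 3 → k)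
    {q a b : MvPowerSeries (Fin 3) k} (c t : MvPowerSeries (Fin 3) k) {r : k}
    (hr : r ≠ 0) (v : Fin 3 → MvPowerSeries (Fin 3) k)
    (hu : ∀ i, constantCoeff (![a, b, c] i) = 0) (hv : ∀ i, constantCoeff (v i) = 0)
    (huv : ∀ φ : MvPowerSeries (Fin 3) k →+* MvPowerSeries (Fin 3) k,
      (∀ i, φ (X i) = ![a, b, c] i) → ∀ i, φ (v i) = X i)
    (hvu : ∀ φ : MvPowerSeries (Fin 3) k →+* MvPowerSeries (Fin 3) k,
      (∀ i, φ (X i) = v i) → ∀ i, φ (![a, b, c] i) = X i)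
    (hq : constantCoeff q = 0)
    (hφ : ∀ φ : MvPowerSeries (Fin 3) k →+* PowerSeries k,
      (∀ i, φ (X i) = PowerSeries.C (p i) * PowerSeries.X) →
        φ a = 0 ∧ φ b = 0 ∧ φ q = PowerSeries.C r * PowerSeries.X ^ 2)
    (hline : ∀ i, X i - C (p i) * t ∈ Ideal.span {q, a, b})
    (ht : t ^ 2 ∈ Ideal.span {q, a, b}) :
    Ideal.span {X 0 ^ 2 - X 1 ^ 2, X 0 ^ 2 - X 2 ^ 2, X 0 * X 1, X 0 * X 2, X 1 * X 2} ≤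
      Ideal.span {q, a, b} ∧
    RingTheory.Sequence.IsRegular (MvPowerSeries (Fin 3) k) [q, a, b] ∧
    IsArtinianRing (MvPowerSeries (Fin 3) k ⧸ Ideal.span {q, a, b}) ∧
    ∀ c₁ c₂ c₃ c₄ c₅ : MvPowerSeries (Fin 3) k,
      c₁ * (X 0 ^ 2 - X 1 ^ 2) + (c₂ * (X 0 ^ 2 - X 2 ^ 2) + (c₃ * (X 0 * X 1) +
        (c₄ * (X 0 * X 2) + c₅ * (X 1 * X 2)))) ∈
          Ideal.span {X 0, X 1, X 2} * Ideal.span {q, a, b} →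
      constantCoeff c₁ * (p 0 ^ 2 - p 1 ^ 2) + constantCoeff c₂ * (p 0 ^ 2 - p 2 ^ 2) +
        constantCoeff c₃ * (p 0 * p 1) + constantCoeff c₄ * (p 0 * p 2) +
        constantCoeff c₅ * (p 1 * p 2) = 0 := by
  obtain ⟨e, he⟩ := exists_ringEquiv_subst _ v hu hv huv hvu
  obtain ⟨φ, hX, hC⟩ := exists_ringHom_powerSeries_line p
  obtain ⟨hφa, hφb, hφq⟩ := hφ φ hX
  have hmem := X_mul_X_mem_of_line p t hline ht
  refine ⟨?_, ?_, isArtinianRing_quotient hmem, fun c₁ c₂ c₃ c₄ c₅ hc => ?_⟩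
  · simp only [Ideal.span_le, Set.insert_subset_iff, Set.singleton_subset_iff, SetLike.mem_coe,
      pow_two]
    exact ⟨sub_mem (hmem _ _) (hmem _ _), sub_mem (hmem _ _) (hmem _ _), hmem _ _, hmem _ _,
      hmem _ _⟩
  · refine isRegular_of_ringEquiv e φ (zero_ne_one (α := Fin 3)) (he 0) (he 1)
      hφa hφb ?_ hq (hu 0) (hu 1)
    rw [hφq]
    intro h
    have := congrArg (PowerSeries.coeff 2) h
    simp [PowerSeries.coeff_X_pow, hr] at this
  · have hm : ∀ f ∈ Ideal.span {X 0, X 1, X 2}, PowerSeries.X ∣ φ f := by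
      have hle : Ideal.span {X 0, X 1, X 2} ≤ (Ideal.span {PowerSeries.X}).comap φ := by
        simp [Ideal.span_le, Set.insert_subset_iff, Ideal.mem_span_singleton, hX]
      exact fun f hf => Ideal.mem_span_singleton.1 (hle hf)
    have h := PowerSeries.X_pow_dvd_of_mem_mul_span φ (n := 2) hm (hφq ▸ dvd_mul_left _ _)
      hφa hφb hc
    have heq : φ (c₁ * (X 0 ^ 2 - X 1 ^ 2) + (c₂ * (X 0 ^ 2 - X 2 ^ 2) + (c₃ * (X 0 * X 1) +
        (c₄ * (X 0 * X 2) + c₅ * (X 1 * X 2))))) = PowerSeries.X ^ 2 *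
        (φ c₁ * PowerSeries.C (p 0 ^ 2 - p 1 ^ 2) + φ c₂ * PowerSeries.C (p 0 ^ 2 - p 2 ^ 2) +
          φ c₃ * PowerSeries.C (p 0 * p 1) + φ c₄ * PowerSeries.C (p 0 * p 2) +
          φ c₅ * PowerSeries.C (p 1 * p 2)) := by
      simp only [map_add, map_sub, map_mul, map_pow, hX]
      ring
    have hX0 : (PowerSeries.X : PowerSeries k) ^ 2 ≠ 0 := pow_ne_zero _ PowerSeries.X_ne_zero
    rw [heq, pow_succ, mul_dvd_mul_iff_left hX0, PowerSeries.X_dvd_iff] at h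
    simpa [hC] using h

/-- **Example 5.2 (short Gorenstein ring, `e = 3`).** Let `k` be a field of characteristic
`≠ 2` and `Q = k⟦x,y,z⟧` with `𝔪 = (x,y,z)`.  Set `I = (x²-y², x²-z², xy, xz, yz)` and
`J₁ = (x²-y², y-z, x)`, `J₂ = (y²-z², y, x)`, `J₃ = (xy, x-y, x-z)`,
`J₄ = (x²-y²+yz-xy, y-z, x-y-z)`, `J₅ = (xy-xz, y, x-z)`.  Then `I ⊆ J_i` for each `i`, each
of the five generating triples is a `Q`-regular sequence (so each `Q/J_i` is artinian), and
any `g ∈ I` lying in `𝔪J_i` for all `i` lies in `𝔪I`. -/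
theorem stmt12 (k : Type*) [Field k] (hchar : ringChar k ≠ 2)
    (x y z : MvPowerSeries (Fin 3) k)
    (hx : x = X 0) (hy : y = X 1) (hz : z = X 2)
    (m I J1 J2 J3 J4 J5 : Ideal (MvPowerSeries (Fin 3) k))
    (hm : m = Ideal.span {x, y, z})
    (hI : I = Ideal.span {x ^ 2 - y ^ 2, x ^ 2 - z ^ 2, x * y, x * z, y * z})
    (hJ1 : J1 = Ideal.span {x ^ 2 - y ^ 2, y - z, x})
    (hJ2 : J2 = Ideal.span {y ^ 2 - z ^ 2, y, x})
    (hJ3 : J3 = Ideal.span {x * y, x - y, x - z})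
    (hJ4 : J4 = Ideal.span {x ^ 2 - y ^ 2 + y * z - x * y, y - z, x - y - z})
    (hJ5 : J5 = Ideal.span {x * y - x * z, y, x - z}) :
    (I ≤ J1 ∧ I ≤ J2 ∧ I ≤ J3 ∧ I ≤ J4 ∧ I ≤ J5) ∧
    (RingTheory.Sequence.IsRegular (MvPowerSeries (Fin 3) k) [x ^ 2 - y ^ 2, y - z, x] ∧
     RingTheory.Sequence.IsRegular (MvPowerSeries (Fin 3) k) [y ^ 2 - z ^ 2, y, x] ∧
     RingTheory.Sequence.IsRegular (MvPowerSeries (Fin 3) k) [x * y, x - y, x - z] ∧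
     RingTheory.Sequence.IsRegular (MvPowerSeries (Fin 3) k)
       [x ^ 2 - y ^ 2 + y * z - x * y, y - z, x - y - z] ∧
     RingTheory.Sequence.IsRegular (MvPowerSeries (Fin 3) k) [x * y - x * z, y, x - z]) ∧
    (IsArtinianRing (MvPowerSeries (Fin 3) k ⧸ J1) ∧
     IsArtinianRing (MvPowerSeries (Fin 3) k ⧸ J2) ∧
     IsArtinianRing (MvPowerSeries (Fin 3) k ⧸ J3) ∧
     IsArtinianRing (MvPowerSeries (Fin 3) k ⧸ J4) ∧
     IsArtinianRing (MvPowerSeries (Fin 3) k ⧸ J5)) ∧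
    (∀ g ∈ I, g ∈ m * J1 → g ∈ m * J2 → g ∈ m * J3 → g ∈ m * J4 → g ∈ m * J5 →
      g ∈ m * I) := by
  subst hx hy hz hm hI hJ1 hJ2 hJ3 hJ4 hJ5
  have h2 : (2 : k) ≠ 0 := Ring.two_ne_zero hchar
  have hC2 : (C 2⁻¹ : MvPowerSeries (Fin 3) k) * 2 = 1 := by
    rw [← map_ofNat (C (σ := Fin 3) (R := k)) 2, ← map_mul, inv_mul_cancel₀ h2, map_one]
  obtain ⟨hI1, hR1, hA1, hL1⟩ := triple_facts (k := k) ![0, 1, 1] (q := X 0 ^ 2 - X 1 ^ 2)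
    (a := X 1 - X 2) (b := X 0) (X 2) (X 2) (r := -1) (neg_ne_zero.2 one_ne_zero)
    ![X 1, X 0 + X 2, X 2] (by simp [Fin.forall_fin_succ]) (by simp [Fin.forall_fin_succ])
    (fun φ hφ => by simp [Fin.forall_fin_succ, hφ])
    (fun φ hφ => by simp [Fin.forall_fin_succ, hφ])
    (by simp) (fun φ hφ => by simp [hφ])
    (by
      simp only [Fin.forall_fin_succ]
      exact ⟨Ideal.mem_span_triple_of_eq 0 0 1 (by simp),
        Ideal.mem_span_triple_of_eq 0 1 0 (by simp),
        Ideal.mem_span_triple_of_eq 0 0 0 (by simp),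
        fun i => i.elim0⟩)
    (Ideal.mem_span_triple_of_eq (-1) (-(X 1 + X 2)) (X 0) (by ring))
  obtain ⟨hI2, hR2, hA2, hL2⟩ := triple_facts (k := k) ![0, 0, 1] (q := X 1 ^ 2 - X 2 ^ 2)
    (a := X 1) (b := X 0) (X 2) (X 2) (r := -1) (neg_ne_zero.2 one_ne_zero)
    ![X 1, X 0, X 2] (by simp [Fin.forall_fin_succ]) (by simp [Fin.forall_fin_succ])
    (fun φ hφ => by simp [Fin.forall_fin_succ, hφ])
    (fun φ hφ => by simp [Fin.forall_fin_succ, hφ])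
    (by simp) (fun φ hφ => by simp [hφ])
    (by
      simp only [Fin.forall_fin_succ]
      exact ⟨Ideal.mem_span_triple_of_eq 0 0 1 (by simp),
        Ideal.mem_span_triple_of_eq 0 1 0 (by simp),
        Ideal.mem_span_triple_of_eq 0 0 0 (by simp),
        fun i => i.elim0⟩)
    (Ideal.mem_span_triple_of_eq (-1) (X 1) 0 (by ring))
  obtain ⟨hI3, hR3, hA3, hL3⟩ := triple_facts (k := k) ![1, 1, 1] (q := X 0 * X 1)
    (a := X 0 - X 1) (b := X 0 - X 2) (X 0) (X 0) (r := 1) one_ne_zero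
    ![X 2, X 2 - X 0, X 2 - X 1] (by simp [Fin.forall_fin_succ]) (by simp [Fin.forall_fin_succ])
    (fun φ hφ => by simp [Fin.forall_fin_succ, hφ])
    (fun φ hφ => by simp [Fin.forall_fin_succ, hφ])
    (by simp) (fun φ hφ => by simp [hφ]; ring)
    (by
      simp only [Fin.forall_fin_succ]
      exact ⟨Ideal.mem_span_triple_of_eq 0 0 0 (by simp),
        Ideal.mem_span_triple_of_eq 0 (-1) 0 (by simp),
        Ideal.mem_span_triple_of_eq 0 0 (-1) (by simp),
        fun i => i.elim0⟩)
    (Ideal.mem_span_triple_of_eq 1 (X 0) 0 (by ring))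
  obtain ⟨hI4, hR4, hA4, hL4⟩ := triple_facts (k := k) ![2, 1, 1]
    (q := X 0 ^ 2 - X 1 ^ 2 + X 1 * X 2 - X 0 * X 1)
    (a := X 1 - X 2) (b := X 0 - X 1 - X 2) (X 2) (X 2) (r := 2) h2
    ![X 1 + X 0 + X 2 + X 2, X 0 + X 2, X 2] (by simp [Fin.forall_fin_succ])
    (by simp [Fin.forall_fin_succ])
    (fun φ hφ => by simp [Fin.forall_fin_succ, hφ]; ring)
    (fun φ hφ => by simp [Fin.forall_fin_succ, hφ]; ring)
    (by simp) (fun φ hφ => by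
      have hC : PowerSeries.C (2 : k) = 2 := map_ofNat _ 2
      simp [hφ, hC]
      constructor <;> ring)
    (by
      simp only [Fin.forall_fin_succ]
      exact ⟨Ideal.mem_span_triple_of_eq 0 1 1 (by
          have hC : (C 2 : MvPowerSeries (Fin 3) k) = 2 := map_ofNat _ 2
          simp [hC]; ring),
        Ideal.mem_span_triple_of_eq 0 1 0 (by simp),
        Ideal.mem_span_triple_of_eq 0 0 0 (by simp),
        fun i => i.elim0⟩)
    (Ideal.mem_span_triple_of_eq (C 2⁻¹) (C 2⁻¹ * (X 1 - X 2)) (-(C 2⁻¹ * (X 0 + X 2)))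
      (by linear_combination -(X 2) ^ 2 * hC2))
  obtain ⟨hI5, hR5, hA5, hL5⟩ := triple_facts (k := k) ![1, 0, 1] (q := X 0 * X 1 - X 0 * X 2)
    (a := X 1) (b := X 0 - X 2) (X 2) (X 2) (r := -1) (neg_ne_zero.2 one_ne_zero)
    ![X 1 + X 2, X 0, X 2] (by simp [Fin.forall_fin_succ]) (by simp [Fin.forall_fin_succ])
    (fun φ hφ => by simp [Fin.forall_fin_succ, hφ])
    (fun φ hφ => by simp [Fin.forall_fin_succ, hφ])
    (by simp) (fun φ hφ => by simp [hφ]; ring)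
    (by
      simp only [Fin.forall_fin_succ]
      exact ⟨Ideal.mem_span_triple_of_eq 0 0 1 (by simp),
        Ideal.mem_span_triple_of_eq 0 1 0 (by simp),
        Ideal.mem_span_triple_of_eq 0 0 0 (by simp),
        fun i => i.elim0⟩)
    (Ideal.mem_span_triple_of_eq (-1) (X 0) (-X 2) (by ring))
  refine ⟨⟨hI1, hI2, hI3, hI4, hI5⟩, ⟨hR1, hR2, hR3, hR4, hR5⟩, ⟨hA1, hA2, hA3, hA4, hA5⟩, ?_⟩
  intro g hg hg1 hg2 hg3 hg4 hg5
  simp only [Ideal.mem_span_insert, Ideal.mem_span_singleton'] at hg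
  obtain ⟨c₁, _, ⟨c₂, _, ⟨c₃, _, ⟨c₄, _, ⟨c₅, rfl⟩, rfl⟩, rfl⟩, rfl⟩, rfl⟩ := hg
  have e1 := hL1 _ _ _ _ _ hg1
  have e2 := hL2 _ _ _ _ _ hg2
  have e3 := hL3 _ _ _ _ _ hg3
  have e4 := hL4 _ _ _ _ _ hg4
  have e5 := hL5 _ _ _ _ _ hg5
  simp at e1 e2 e3 e4 e5
  have hc₁ : constantCoeff c₁ = 0 := by
    refine (mul_eq_zero.1 (?_ : 2 * constantCoeff c₁ = 0)).resolve_left h2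
    linear_combination e4 - 2 * e3 + e1 - 2 * e2
  have hc₅ : constantCoeff c₅ = 0 := by linear_combination e1 + hc₁ + e2
  have hc₄ : constantCoeff c₄ = 0 := by linear_combination e5 - hc₁
  have hc₃ : constantCoeff c₃ = 0 := by linear_combination e3 - hc₄ - hc₅
  have hm {c f : MvPowerSeries (Fin 3) k} {I : Ideal (MvPowerSeries (Fin 3) k)}
      (hc : constantCoeff c = 0) (hf : f ∈ I) : c * f ∈ Ideal.span {X 0, X 1, X 2} * I := by
    refine Ideal.mul_mem_mul (Ideal.span_mono ?_ (mem_span_range_X hc)) hf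
    simp [Set.range_subset_iff, Fin.forall_fin_succ]
  exact add_mem (hm hc₁ (Ideal.subset_span (by simp)))
    (add_mem (hm e2 (Ideal.subset_span (by simp)))
    (add_mem (hm hc₃ (Ideal.subset_span (by simp)))
    (add_mem (hm hc₄ (Ideal.subset_span (by simp))) (hm hc₅ (Ideal.subset_span (by simp))))))
end

section
/- Let (Q, m, k) be a regular local ring with residue field k infinite, and let I ⊆ m² be a nonzero ideal such that all minimal generators of I have the same m-adic order, i.e., there is d ≥ 2 with I ⊆ m^d and every element of I ∖ mI lies outside m^{d+1}. If I is not generated by a regular sequence on Q, then there is no nonzero k-subspace W of I/mI with the following property: W is contained in the image in I/mI of I ∩ mJ for every ideal J of Q that contains I, is generated by a regular sequence of length dim Q, and has Q/J artinian. Equivalently, for every nonzero g ∈ I ∖ mI there exists an ideal J ⊇ I generated by a regular sequence of length dim Q with Q/J artinian and g ∉ mJ. -/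
open IsLocalRing

namespace IsLocalRing

variable {R : Type*} [CommRing R]

/-- If one coefficient of a linear combination `y` of generators of the maximal ideal is a unit,
then modulo `y` the other generators suffice. -/
lemma map_mk_span_succAbove_eq {n : ℕ} (x a : Fin (n + 1) → R) {i : Fin (n + 1)}
    (ha : IsUnit (a i)) :
    Ideal.span (Set.range fun j ↦ Ideal.Quotient.mk (Ideal.span {∑ j, a j * x j})
      (x (i.succAbove j))) =
    (Ideal.span (Set.range x)).map (Ideal.Quotient.mk (Ideal.span {∑ j, a j * x j})) := by
  set y := ∑ j, a j * x j with hy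
  rw [Ideal.map_span]
  apply le_antisymm
  · rw [Ideal.span_le]
    rintro _ ⟨j, rfl⟩
    exact Ideal.subset_span ⟨_, ⟨_, rfl⟩, rfl⟩
  · rw [Ideal.span_le]
    rintro _ ⟨_, ⟨j, rfl⟩, rfl⟩
    induction j using Fin.succAboveCases i with
    | p j => exact Ideal.subset_span ⟨j, rfl⟩
    | x =>
      have h0 : Ideal.Quotient.mk (Ideal.span {y}) y = 0 :=
        Ideal.Quotient.eq_zero_iff_mem.mpr (Ideal.mem_span_singleton_self y)
      replace h0 : Ideal.Quotient.mk (Ideal.span {y})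
          (a i * x i + ∑ j, a (i.succAbove j) * x (i.succAbove j)) = 0 := by
        rwa [← Fin.sum_univ_succAbove (fun j ↦ a j * x j) i]
      rw [map_add, map_mul, add_eq_zero_iff_eq_neg] at h0
      rw [SetLike.mem_coe, ← Ideal.unit_mul_mem_iff_mem _ (ha.map (Ideal.Quotient.mk _)), h0,
        neg_mem_iff, map_sum]
      refine Ideal.sum_mem _ fun j _ ↦ ?_
      rw [map_mul]
      exact Ideal.mul_mem_left _ _ (Ideal.subset_span ⟨j, rfl⟩)

variable [IsLocalRing R]

lemma map_mk_maximalIdeal {I : Ideal R} [IsLocalRing (R ⧸ I)] (hI : I ≠ ⊤) :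
    (maximalIdeal R).map (Ideal.Quotient.mk I) = maximalIdeal (R ⧸ I) := by
  have := IsLocalHom.of_surjective (Ideal.Quotient.mk I) Ideal.Quotient.mk_surjective
  ext x
  obtain ⟨x, rfl⟩ := Ideal.Quotient.mk_surjective x
  simp [sup_eq_left.mpr (le_maximalIdeal hI)]

variable [IsNoetherianRing R]

lemma ringKrullDim_le_of_ofList_eq_maximalIdeal {l : List R}
    (hl : Ideal.ofList l = maximalIdeal R) : ringKrullDim R ≤ l.length := by
  classical
  grw [ringKrullDim_le_spanFinrank_maximalIdeal R]
  have h : (l.toFinset : Set R) = {r | r ∈ l} := by ext; simp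
  rw [← hl, Ideal.ofList, ← h]
  have := Submodule.spanFinrank_span_le_ncard_of_finite (R := R) l.toFinset.finite_toSet
  rw [Set.ncard_coe_finset] at this
  exact_mod_cast this.trans l.toFinset_card_le

lemma ringKrullDim_le_ringKrullDim_quotient_ofList_add_length {l : List R}
    (hl : Ideal.ofList l ≤ maximalIdeal R) :
    ringKrullDim R ≤ ringKrullDim (R ⧸ Ideal.ofList l) + l.length := by
  classical
  have h : (l.toFinset : Set R) = {r | r ∈ l} := by ext; simp
  have := ringKrullDim_le_ringKrullDim_quotient_add_card l.toFinset (by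
    rw [ringJacobson_eq_maximalIdeal, h]
    exact Ideal.span_le.mp hl)
  rw [h] at this
  grw [this, Ideal.ofList, l.toFinset_card_le]

/-- An element of the maximal ideal outside its square and outside every minimal prime. -/
lemma exists_mem_maximalIdeal_notMem_sq_notMem_minimalPrimes (h : 0 < ringKrullDim R) :
    ∃ y ∈ maximalIdeal R, y ∉ maximalIdeal R ^ 2 ∧ ∀ P ∈ minimalPrimes R, y ∉ P := by
  classical
  have hht : (maximalIdeal R).height ≠ 0 := by
    rw [← maximalIdeal_height_eq_ringKrullDim] at h
    exact (by exact_mod_cast h : 0 < (maximalIdeal R).height).ne'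
  have hfin := minimalPrimes.finite_of_isNoetherianRing R
  by_contra! hcon
  have hsub : (maximalIdeal R : Set R) ⊆
      ⋃ P ∈ (↑(insert (maximalIdeal R ^ 2) hfin.toFinset) : Set (Ideal R)), (P : Set R) := by
    intro y hy
    by_cases hy2 : y ∈ maximalIdeal R ^ 2
    · exact Set.mem_biUnion (by simp) hy2
    · obtain ⟨P, hP, hyP⟩ := hcon y hy hy2
      exact Set.mem_biUnion (by simp [hP]) hyP
  refine absurd ((Ideal.subset_union_prime (f := fun P ↦ P) (maximalIdeal R ^ 2)
    (maximalIdeal R ^ 2) ?_).mp hsub) ?_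
  rotate_left
  · rintro ⟨P, hP, hle⟩
    rw [Finset.mem_insert, Set.Finite.mem_toFinset] at hP
    obtain rfl | hP := hP
    · apply hht
      have : maximalIdeal R = ⊥ := by
        apply Submodule.eq_bot_of_le_smul_of_le_jacobson_bot (maximalIdeal R) _
          (IsNoetherian.noetherian _)
        · rw [smul_eq_mul, ← pow_two]; exact hle
        · exact maximalIdeal_le_jacobson _
      have hf := (isField_iff_maximalIdeal_eq).mpr this
      have := ringKrullDim_eq_zero_of_isField hf
      exact absurd this h.ne'
    · have := hP.1.1
      have heq : P = maximalIdeal R := le_antisymm (le_maximalIdeal_of_isPrime P) hle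
      exact hht (Ideal.height_eq_zero_iff.mpr (heq ▸ hP))
  · intro P hP h1 _
    rw [Finset.mem_insert, Set.Finite.mem_toFinset] at hP
    exact (hP.resolve_left h1).1.1

/-- A Noetherian local ring whose maximal ideal is generated by `dim R` elements is a domain. -/
theorem isDomain_of_span_range_eq_maximalIdeal (n : ℕ) {R : Type*} [CommRing R] [IsLocalRing R]
    [IsNoetherianRing R] (x : Fin n → R) (hx : Ideal.span (Set.range x) = maximalIdeal R)
    (hn : n ≤ ringKrullDim R) : IsDomain R := by
  induction n generalizing R with
  | zero =>
    have : maximalIdeal R = ⊥ := by simp [← hx]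
    exact (isField_iff_maximalIdeal_eq.mpr this).isDomain
  | succ n ih =>
    obtain ⟨y, hym, hy2, hymin⟩ := exists_mem_maximalIdeal_notMem_sq_notMem_minimalPrimes
      (lt_of_lt_of_le (by exact_mod_cast n.succ_pos) hn)
    obtain ⟨a, rfl⟩ := Ideal.mem_span_range_iff_exists_fun.mp (hx ▸ hym)
    obtain ⟨i, hi⟩ : ∃ i, IsUnit (a i) := by
      by_contra! hcon
      refine hy2 (Ideal.sum_mem _ fun j _ ↦ ?_)
      rw [pow_two]
      exact Ideal.mul_mem_mul ((mem_maximalIdeal _).mpr (hcon j))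
        (hx ▸ Ideal.subset_span ⟨j, rfl⟩)
    set y := ∑ j, a j * x j with hy
    have hle : Ideal.span {y} ≤ maximalIdeal R := by simpa [Ideal.span_le] using hym
    have hne : Ideal.span {y} ≠ ⊤ := fun h ↦ (h ▸ hle).not_gt (lt_top_iff_ne_top.mpr
      (maximalIdeal.isMaximal R).ne_top)
    have : Nontrivial (R ⧸ Ideal.span {y}) := Ideal.Quotient.nontrivial_iff.mpr hne
    have := IsLocalRing.of_surjective' (Ideal.Quotient.mk (Ideal.span {y}))
      Ideal.Quotient.mk_surjective
    have hdom : IsDomain (R ⧸ Ideal.span {y}) := by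
      refine ih _ ((map_mk_span_succAbove_eq x a hi).trans ?_) ?_
      · exact hx ▸ map_mk_maximalIdeal hne
      · have := ringKrullDim_le_ringKrullDim_quotient_ofList_add_length (l := [y])
          (by simpa using hle)
        rw [Ideal.ofList_singleton] at this
        rw [← ENat.WithBot.add_le_add_natCast_right_iff (c := 1)]
        exact le_trans (by exact_mod_cast hn) this
    have hprime := (Ideal.Quotient.isDomain_iff_prime _).mp hdom
    obtain ⟨P, hP, hPle⟩ := Ideal.exists_minimalPrimes_le (bot_le : ⊥ ≤ Ideal.span {y})
    have hPp := hP.1.1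
    have hbot : P = ⊥ := by
      apply Submodule.eq_bot_of_le_smul_of_le_jacobson_bot (maximalIdeal R) _
        (IsNoetherian.noetherian _) _ (maximalIdeal_le_jacobson _)
      intro p hp
      obtain ⟨b, rfl⟩ := Ideal.mem_span_singleton'.mp (hPle hp)
      rw [mul_comm]
      exact Ideal.mul_mem_mul hym ((hPp.mem_or_mem hp).resolve_right (hymin P hP))
    subst hbot
    exact IsDomain.of_bot_isPrime R

theorem isPrime_ofList_of_append {l₁ l₂ : List R}
    (hl : Ideal.ofList (l₁ ++ l₂) = maximalIdeal R)
    (hlen : (l₁ ++ l₂).length ≤ ringKrullDim R) : (Ideal.ofList l₁).IsPrime := by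
  have hle : Ideal.ofList l₁ ≤ maximalIdeal R := by
    rw [← hl, Ideal.ofList_append]; exact le_sup_left
  have hne : Ideal.ofList l₁ ≠ ⊤ := fun h ↦ (h ▸ hle).not_gt (lt_top_iff_ne_top.mpr
    (maximalIdeal.isMaximal R).ne_top)
  have : Nontrivial (R ⧸ Ideal.ofList l₁) := Ideal.Quotient.nontrivial_iff.mpr hne
  have := IsLocalRing.of_surjective' (Ideal.Quotient.mk (Ideal.ofList l₁))
    Ideal.Quotient.mk_surjective
  rw [← Ideal.Quotient.isDomain_iff_prime]
  refine isDomain_of_span_range_eq_maximalIdeal l₂.length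
    (fun j ↦ Ideal.Quotient.mk (Ideal.ofList l₁) (l₂.get j)) ?_ ?_
  · have h : Ideal.ofList l₂ = Ideal.span (Set.range l₂.get) := by
      rw [Set.range_list_get, Ideal.ofList]
    rw [← map_mk_maximalIdeal hne, ← hl, Ideal.ofList_append, Ideal.map_sup,
      Ideal.map_quotient_self, bot_sup_eq, h, Ideal.map_span, ← Set.range_comp]
    rfl
  · have := ringKrullDim_le_ringKrullDim_quotient_ofList_add_length hle
    rw [← ENat.WithBot.add_le_add_natCast_right_iff (c := l₁.length)]
    refine le_trans (le_trans (le_of_eq ?_) hlen) this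
    rw [List.length_append, add_comm]
    norm_cast

lemma notMem_ofList_of_append {l₁ l₂ : List R} {z : R}
    (hl : Ideal.ofList (l₁ ++ z :: l₂) = maximalIdeal R)
    (hlen : (l₁ ++ z :: l₂).length ≤ ringKrullDim R) : z ∉ Ideal.ofList l₁ := by
  intro hz
  have h : Ideal.ofList (l₁ ++ l₂) = maximalIdeal R := by
    rw [← hl, Ideal.ofList_append, Ideal.ofList_append, Ideal.ofList_cons, ← sup_assoc,
      sup_eq_left.mpr ((Ideal.span_singleton_le_iff_mem _).mpr hz)]
  have := hlen.trans (ringKrullDim_le_of_ofList_eq_maximalIdeal h)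
  have : (l₁ ++ z :: l₂).length ≤ (l₁ ++ l₂).length := by exact_mod_cast this
  simp at this

end IsLocalRing

lemma Ideal.sup_pow_le_sup_pow {R : Type*} [CommRing R] (I J : Ideal R) (n : ℕ) :
    (I ⊔ J) ^ n ≤ I ⊔ J ^ n := by
  induction n with
  | zero => simp
  | succ n ih =>
    rw [pow_succ, pow_succ]
    grw [ih]
    rw [Ideal.sup_mul, Ideal.mul_sup (J ^ n)]
    have h₁ : I * (I ⊔ J) ≤ I := Ideal.mul_le_left
    have h₂ : J ^ n * I ≤ I := Ideal.mul_le_right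
    exact sup_le (le_sup_of_le_left h₁) (sup_le (le_sup_of_le_left h₂) le_sup_right)

lemma Ideal.IsPrime.isSMulRegular_quotient {R : Type*} [CommRing R] {P : Ideal R}
    (hP : P.IsPrime) {a : R} (ha : a ∉ P) :
    IsSMulRegular (R ⧸ (P • ⊤ : Submodule R R)) a := by
  rw [smul_eq_mul, Ideal.mul_top, isSMulRegular_iff_right_eq_zero_of_smul]
  intro x hx
  obtain ⟨x, rfl⟩ := Ideal.Quotient.mk_surjective x
  rw [Algebra.smul_def, Ideal.Quotient.algebraMap_eq, ← map_mul,
    Ideal.Quotient.eq_zero_iff_mem] at hx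
  exact Ideal.Quotient.eq_zero_iff_mem.mpr ((hP.mem_or_mem hx).resolve_left ha)

/-- A power of the last member of a regular system of parameters completes the preceding ones to
a regular sequence. -/
theorem IsLocalRing.isRegular_append_pow {R : Type*} [CommRing R] [IsLocalRing R]
    [IsNoetherianRing R] {l : List R} {z : R} (hl : Ideal.ofList (l ++ [z]) = maximalIdeal R)
    (hlen : (l ++ [z]).length ≤ ringKrullDim R) {k : ℕ} (hk : k ≠ 0) :
    RingTheory.Sequence.IsRegular R (l ++ [z ^ k]) := by
  have hmem : ∀ r ∈ l ++ [z], r ∈ maximalIdeal R := fun r hr ↦ hl ▸ Ideal.subset_span hr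
  refine .of_isWeaklyRegular_of_mem_maximalIdeal _ ?_ ⟨fun i hi ↦ ?_⟩
  · intro r hr
    rw [List.mem_append, List.mem_singleton] at hr
    obtain hr | rfl := hr
    · exact hmem r (by simp [hr])
    · exact Ideal.pow_mem_of_mem _ (hmem z (by simp)) k (Nat.pos_of_ne_zero hk)
  · obtain hi' | rfl : i < l.length ∨ i = l.length := by
      simp at hi; omega
    · have hsplit : l ++ [z] = l.take i ++ l[i] :: (l.drop (i + 1) ++ [z]) := by
        rw [← List.cons_append, List.getElem_cons_drop, ← List.append_assoc,
          List.take_append_drop]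
      rw [hsplit] at hl hlen
      rw [List.take_append_of_le_length hi'.le, List.getElem_append_left hi']
      exact (isPrime_ofList_of_append hl hlen).isSMulRegular_quotient
        (notMem_ofList_of_append hl hlen)
    · have hP := isPrime_ofList_of_append hl hlen
      rw [List.take_left, List.getElem_concat_length rfl]
      exact hP.isSMulRegular_quotient fun h ↦
        notMem_ofList_of_append hl hlen (hP.mem_of_pow_mem k h)

namespace MvPolynomial

variable {R σ : Type*} [CommRing R]

lemma exists_isHomogeneous_eval_eq [Finite σ] (x : σ → R) (d : ℕ) {g : R}
    (hg : g ∈ Ideal.span (Set.range x) ^ d) :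
    ∃ F : MvPolynomial σ R, F.IsHomogeneous d ∧ eval x F = g := by
  have := Fintype.ofFinite σ
  induction d generalizing g with
  | zero => exact ⟨C g, isHomogeneous_C _ _, by simp⟩
  | succ d ih =>
    rw [pow_succ] at hg
    induction hg using Submodule.mul_induction_on' with
    | mem_mul_mem a ha b hb =>
      obtain ⟨F, hF, rfl⟩ := ih ha
      obtain ⟨c, rfl⟩ := Ideal.mem_span_range_iff_exists_fun.mp hb
      refine ⟨F * ∑ j, C (c j) * X j, hF.mul (.sum _ _ _ fun j _ ↦ ?_), by simp⟩
      simpa using (isHomogeneous_C σ (c j)).mul (isHomogeneous_X R j)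
    | add a _ b _ iha ihb =>
      obtain ⟨F, hF, rfl⟩ := iha
      obtain ⟨G, hG, rfl⟩ := ihb
      exact ⟨F + G, hF.add hG, by simp⟩

lemma IsHomogeneous.sum_eq_of_mem_support {F : MvPolynomial σ R} {d : ℕ}
    (hF : F.IsHomogeneous d) {s : σ →₀ ℕ} (hs : s ∈ F.support) : ∑ i ∈ s.support, s i = d := by
  rw [← Finsupp.degree_apply, Finsupp.degree_eq_weight_one]
  exact hF (mem_support_iff.mp hs)

lemma IsHomogeneous.eval_mul_left {F : MvPolynomial σ R} {d : ℕ} (hF : F.IsHomogeneous d)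
    (r : R) (b : σ → R) : eval (fun j ↦ r * b j) F = r ^ d * eval b F := by
  rw [eval_eq, eval_eq, Finset.mul_sum]
  refine Finset.sum_congr rfl fun s hs ↦ ?_
  have := hF.sum_eq_of_mem_support hs
  simp_rw [mul_pow, Finset.prod_mul_distrib, Finset.prod_pow_eq_pow_sum, this]
  ring

lemma IsHomogeneous.eval_mem_mul_pow {F : MvPolynomial σ R} {d : ℕ} (hF : F.IsHomogeneous d)
    {I J : Ideal R} (hJ : ∀ s, coeff s F ∈ J) {x : σ → R} (hx : ∀ j, x j ∈ I) :
    eval x F ∈ J * I ^ d := by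
  rw [eval_eq]
  refine Ideal.sum_mem _ fun s hs ↦ Ideal.mul_mem_mul (hJ s) ?_
  have := hF.sum_eq_of_mem_support hs
  rw [← this, ← Finset.prod_pow_eq_pow_sum]
  exact Ideal.prod_mem_prod fun i _ ↦ Ideal.pow_mem_pow (hx i) _

end MvPolynomial

/-- Over an infinite residue field, an element of order exactly `d` is a unit multiple of the `d`-th
power of one generator of the maximal ideal modulo a suitable linear change of the other ones. -/
lemma IsLocalRing.exists_sub_mul_pow_mem_span {R : Type*} [CommRing R] [IsLocalRing R]
    [Infinite (ResidueField R)] {n : ℕ} (x : Fin n → R)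
    (hx : Ideal.span (Set.range x) = maximalIdeal R) {d : ℕ} (hd : d ≠ 0) {g : R}
    (hg : g ∈ maximalIdeal R ^ d) (hg' : g ∉ maximalIdeal R ^ (d + 1)) :
    ∃ (i : Fin n) (c : Fin n → R) (u : R), c i = 1 ∧ IsUnit u ∧
      ∀ P : Ideal R, (∀ j, x j - c j * x i ∈ P) → g - u * x i ^ d ∈ P := by
  obtain ⟨F, hF, rfl⟩ := MvPolynomial.exists_isHomogeneous_eval_eq x d (hx ▸ hg)
  have hne : MvPolynomial.map (residue R) F ≠ 0 := by
    intro h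
    refine hg' ?_
    rw [pow_succ']
    refine hF.eval_mem_mul_pow (fun s ↦ ?_) fun j ↦ hx ▸ Ideal.subset_span ⟨j, rfl⟩
    rw [← residue_eq_zero_iff, ← MvPolynomial.coeff_map, h, MvPolynomial.coeff_zero]
  obtain ⟨a, ha⟩ : ∃ a, MvPolynomial.eval a (MvPolynomial.map (residue R) F) ≠ 0 := by
    by_contra! h
    exact hne (MvPolynomial.funext fun a ↦ by simpa using h a)
  choose b hb using fun j ↦ residue_surjective (R := R) (a j)
  obtain rfl : (fun j ↦ residue R (b j)) = a := funext hb
  have hu : IsUnit (MvPolynomial.eval b F) := by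
    rw [← residue_ne_zero_iff_isUnit, ← MvPolynomial.eval₂_id, MvPolynomial.hom_eval₂]
    simpa [MvPolynomial.eval_map, Function.comp_def] using ha
  obtain ⟨i, hi⟩ : ∃ i, IsUnit (b i) := by
    by_contra! h
    have := hF.eval_mem_mul_pow (J := ⊤) (I := maximalIdeal R) (fun _ ↦ trivial)
      (x := b) fun j ↦ (mem_maximalIdeal _).mpr (h j)
    rw [Ideal.top_mul] at this
    exact (mem_maximalIdeal _).mp (Ideal.pow_le_self hd this) hu
  obtain ⟨v, hv⟩ := hi.exists_left_inv
  refine ⟨i, fun j ↦ v * b j, v ^ d * MvPolynomial.eval b F, hv,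
    ((IsUnit.of_mul_eq_one _ hv).pow d).mul hu, fun P hP ↦ ?_⟩
  rw [mul_comm, ← hF.eval_mul_left, ← hF.eval_mul_left, ← Ideal.Quotient.eq]
  simp_rw [← MvPolynomial.eval₂_id, MvPolynomial.hom_eval₂]
  congr 1
  funext j
  simpa [mul_comm] using Ideal.Quotient.eq.mpr (hP j)

/-- **Equipresented rings (Corollary 3.10).** Let `(Q,𝔪,k)` be a regular local ring with
`k` infinite, and `I ⊆ 𝔪²` a nonzero equipresented ideal: there is `d ≥ 2` with `I ⊆ 𝔪^d`
and every minimal generator of `I` (element of `I ∖ 𝔪I`) lying outside `𝔪^{d+1}`.  If `I`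
is not generated by a `Q`-regular sequence, then for every nonzero `g ∈ I ∖ 𝔪I` there is an
ideal `J ⊇ I` generated by a `Q`-regular sequence of length `dim Q` with `Q/J` artinian and
`g ∉ 𝔪J`.  (Equivalently: no nonzero `k`-subspace of `I/𝔪I` is contained in the image of
`I ∩ 𝔪J` for every such `J`.) -/
theorem stmt14 (Q : Type*) [CommRing Q] [IsLocalRing Q] [IsNoetherianRing Q]
    (hreg : IsRegularLocal Q)
    (e : ℕ) (hdim : ringKrullDim Q = e)
    [Infinite (ResidueField Q)]
    (I : Ideal Q) (hI0 : I ≠ ⊥) (hI2 : I ≤ maximalIdeal Q ^ 2)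
    (d : ℕ) (hd : 2 ≤ d) (hId : I ≤ maximalIdeal Q ^ d)
    (hequi : ∀ f ∈ I, f ∉ maximalIdeal Q * I → f ∉ maximalIdeal Q ^ (d + 1))
    (hnotci : ¬ ∃ rs : List Q, RingTheory.Sequence.IsRegular Q rs ∧
      Ideal.span {r | r ∈ rs} = I) :
    ∀ g ∈ I, g ≠ 0 → g ∉ maximalIdeal Q * I →
      ∃ J : Ideal Q, I ≤ J ∧
        (∃ r : Fin e → Q, RingTheory.Sequence.IsRegular Q (List.ofFn r) ∧
          Ideal.span (Set.range r) = J) ∧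
        IsArtinianRing (Q ⧸ J) ∧
        g ∉ maximalIdeal Q * J := by
  intro g hgI _ hgm
  obtain ⟨n, x, hx, hn⟩ := hreg
  obtain rfl : e = n := by exact_mod_cast hdim.symm.trans hn
  obtain ⟨i, c, u, hci, hu, hgP⟩ := exists_sub_mul_pow_mem_span x hx (d := d) (by omega) (hId hgI)
    (hequi g hgI hgm)
  obtain _ | n := e
  · exact i.elim0
  set y : Fin n → Q := fun j ↦ x (i.succAbove j) - c (i.succAbove j) * x i with hy
  have hmemP : ∀ j, x j - c j * x i ∈ Ideal.ofList (List.ofFn y) := by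
    intro j
    induction j using Fin.succAboveCases i with
    | x => simp [hci]
    | p j => exact Ideal.subset_span (by simp [hy])
  have hmax : Ideal.ofList (List.ofFn y ++ [x i]) = maximalIdeal Q := by
    rw [← hx, Ideal.ofList_append, Ideal.ofList_singleton]
    apply le_antisymm
    · refine sup_le (Ideal.span_le.mpr ?_) ?_
      · intro r hr
        obtain ⟨j, rfl⟩ : ∃ j, y j = r := by simpa using hr
        exact sub_mem (Ideal.subset_span ⟨_, rfl⟩)
          (Ideal.mul_mem_left _ _ (Ideal.subset_span ⟨_, rfl⟩))
      · rw [Ideal.span_singleton_le_iff_mem]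
        exact Ideal.subset_span ⟨_, rfl⟩
    · rw [Ideal.span_le]
      rintro _ ⟨j, rfl⟩
      rw [← sub_add_cancel (x j) (c j * x i)]
      exact Ideal.add_mem _ (Ideal.mem_sup_left (hmemP j))
        (Ideal.mem_sup_right (Ideal.mul_mem_left _ _ (Ideal.mem_span_singleton_self _)))
  have hlen : (List.ofFn y ++ [x i]).length ≤ ringKrullDim Q := by
    rw [hdim]; simp
  have hP := isPrime_ofList_of_append hmax hlen
  have hxP := notMem_ofList_of_append hmax hlen
  have hxm : x i ∈ maximalIdeal Q := hmax ▸ Ideal.subset_span (by simp)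
  set P := Ideal.ofList (List.ofFn y) with hPdef
  have hpow : maximalIdeal Q ^ d ≤ P ⊔ Ideal.span {x i ^ d} := by
    rw [← hmax, Ideal.ofList_append, Ideal.ofList_singleton, ← hPdef,
      ← Ideal.span_singleton_pow]
    exact Ideal.sup_pow_le_sup_pow _ _ _
  have hreg := isRegular_append_pow hmax hlen (k := d) (by omega)
  set r : Fin (n + 1) → Q := Fin.snoc y (x i ^ d) with hr
  have hofFn : List.ofFn r = List.ofFn y ++ [x i ^ d] := by
    rw [List.ofFn_succ', List.concat_eq_append]
    simp [hr]
  have hspan : Ideal.span (Set.range r) = P ⊔ Ideal.span {x i ^ d} := by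
    rw [← Ideal.ofList_singleton, ← Ideal.ofList_append, ← hofFn, Ideal.ofList]
    congr 1
    ext
    rw [Set.mem_ofPred, List.mem_ofFn']
  refine ⟨P ⊔ Ideal.span {x i ^ d}, hId.trans hpow, ⟨r, hofFn ▸ hreg, hspan⟩, ?_, ?_⟩
  · refine quotient_artinian_of_mem_minimalPrimes_of_isLocalRing _ ⟨⟨inferInstance, ?_⟩, ?_⟩
    · exact sup_le (le_maximalIdeal hP.ne_top)
        ((Ideal.span_singleton_le_iff_mem _).mpr (Ideal.pow_mem_of_mem _ hxm d (by omega)))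
    · rintro K ⟨hK, hJK⟩ -
      exact hK.le_of_pow_le (hpow.trans hJK)
  · intro hgJ
    rw [Ideal.mul_sup, Submodule.mem_sup] at hgJ
    obtain ⟨p, hp, q, hq, rfl⟩ := hgJ
    obtain ⟨t, ht, rfl⟩ := Ideal.mem_mul_span_singleton.mp hq
    have h := sub_mem (hgP P hmemP) (Ideal.mul_le_right (I := maximalIdeal Q) hp)
    rw [show p + t * x i ^ d - u * x i ^ d - p = (t - u) * x i ^ d by ring] at h
    have htu : IsUnit (t - u) := by
      by_contra h'
      have h₁ : u ∈ maximalIdeal Q := by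
        simpa using sub_mem ht ((mem_maximalIdeal _).mpr h')
      exact (mem_maximalIdeal _).mp h₁ hu
    exact hxP (hP.mem_of_pow_mem d ((Ideal.unit_mul_mem_iff_mem _ htu).mp h))
end
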